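/- For every n ≥ 0, the abelian complexity function ρ of the ordinary paperfolding word satisfies ρ(16n+15) = ρ(2n+2) + 1. -/

import Mathlib

/-- The ordinary paperfolding word over `{0,1}`, indexed from 1:
writing `n = n' * 2^k` with `n'` odd, `pf n = 0` if `n' ≡ 1 (mod 4)`
and `pf n = 1` if `n' ≡ 3 (mod 4)`.  (The value at `0` is irrelevant.) -/
def pf (n : ℕ) : ℕ := if (n / 2 ^ (n.factorization 2)) % 4 = 1 then 0 else 1

/-- The factor `f_i f_{i+1} ⋯ f_{i+n-1}` of the paperfolding word,
of length `n`, starting at position `i`. -/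
def pfFactor (i n : ℕ) : List ℕ := (List.range n).map (fun j => pf (i + j))

/-- `w` is a factor of the ordinary paperfolding word. -/
def IsPFFactor (w : List ℕ) : Prop := ∃ i : ℕ, 1 ≤ i ∧ w = pfFactor i w.length

/-- The abelian complexity function of the ordinary paperfolding word:
the number of abelian equivalence classes of factors of length `n`,
where the class of a factor `w` is determined by the pair
`(|w|_0, |w|_1)` of numbers of occurrences of `0` and `1` in `w`. -/
noncomputable def ρ (n : ℕ) : ℕ :=
  {p : ℕ × ℕ | ∃ i : ℕ, 1 ≤ i ∧
    p = ((pfFactor i n).count 0, (pfFactor i n).count 1)}.ncard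

/-- `Δ w = |w|_0 - |w|_1`. -/
def Δ (w : List ℕ) : ℤ := (w.count 0 : ℤ) - (w.count 1 : ℤ)

/-- `M n` is the maximum of `Δ w` over all factors `w` of the
paperfolding word of length `n`. -/
noncomputable def M (n : ℕ) : ℤ :=
  sSup {d : ℤ | ∃ i : ℕ, 1 ≤ i ∧ d = Δ (pfFactor i n)}

theorem pf_eq_zero_or_one (n : ℕ) : pf n = 0 ∨ pf n = 1 := by
  unfold pf
  split_ifs <;> simp

theorem pf_two_mul (n : ℕ) : pf (2 * n) = pf n := by
  rcases Nat.eq_zero_or_pos n with rfl | hn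
  · rfl
  · have h : (2 * n).factorization 2 = n.factorization 2 + 1 := by
      rw [Nat.factorization_mul (by norm_num) hn.ne', Finsupp.add_apply,
        Nat.prime_two.factorization_self, add_comm]
    unfold pf
    rw [h, pow_succ', Nat.mul_div_mul_left _ _ (by norm_num)]

theorem pf_two_mul_add_one (n : ℕ) : pf (2 * n + 1) = n % 2 := by
  have h : (2 * n + 1).factorization 2 = 0 :=
    Nat.factorization_eq_zero_of_not_dvd (by omega)
  unfold pf
  rw [h, pow_zero, Nat.div_one]
  split_ifs <;> omega

/-- The number of ones in the factor of length `n` starting at position `i`. -/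
def pfOnes (i n : ℕ) : ℕ := ∑ j ∈ Finset.range n, pf (i + j)

/-- The numbers of ones in the factors of length `n`. -/
def pfOnesSet (n : ℕ) : Set ℕ := {c | ∃ i, 1 ≤ i ∧ c = pfOnes i n}

/-- The number of ones at the `n` consecutive odd positions starting at `2 * i + 1`. -/
def pfOddOnes (i n : ℕ) : ℕ := ∑ j ∈ Finset.range n, pf (2 * (i + j) + 1)

theorem pfOnes_succ (i n : ℕ) : pfOnes i (n + 1) = pfOnes i n + pf (i + n) :=
  Finset.sum_range_succ _ _

theorem pfOnes_succ_left (i n : ℕ) : pfOnes i (n + 1) = pf i + pfOnes (i + 1) n := by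
  unfold pfOnes
  rw [Finset.sum_range_succ', add_comm]
  simp only [Nat.add_zero, add_assoc, add_comm 1]

theorem pfOddOnes_succ (i n : ℕ) :
    pfOddOnes i (n + 1) = pfOddOnes i n + pf (2 * (i + n) + 1) :=
  Finset.sum_range_succ _ _

theorem pfOddOnes_two_mul (i k : ℕ) : pfOddOnes i (2 * k) = k := by
  induction k with
  | zero => rfl
  | succ k ih =>
    rw [show 2 * (k + 1) = 2 * k + 1 + 1 by ring, pfOddOnes_succ, pfOddOnes_succ, ih,
      pf_two_mul_add_one, pf_two_mul_add_one]
    omega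

theorem pfOddOnes_two_mul_add_one (i k : ℕ) : pfOddOnes i (2 * k + 1) = k + i % 2 := by
  rw [pfOddOnes_succ, pfOddOnes_two_mul, pf_two_mul_add_one]
  omega

theorem pfOnes_even_even (i n : ℕ) : pfOnes (2 * i) (2 * n) = pfOddOnes i n + pfOnes i n := by
  induction n with
  | zero => rfl
  | succ n ih =>
    rw [show 2 * (n + 1) = 2 * n + 1 + 1 by ring, pfOnes_succ, pfOnes_succ, ih, pfOddOnes_succ,
      pfOnes_succ, ← pf_two_mul (i + n), show 2 * i + (2 * n + 1) = 2 * (i + n) + 1 by ring,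
      ← mul_add]
    ring

theorem pfOnes_even_odd (i n : ℕ) :
    pfOnes (2 * i) (2 * n + 1) = pfOddOnes i n + pfOnes i (n + 1) := by
  rw [pfOnes_succ, pfOnes_even_even, pfOnes_succ, ← mul_add, pf_two_mul, add_assoc]

theorem pfOnes_odd_odd (i n : ℕ) :
    pfOnes (2 * i + 1) (2 * n + 1) = pfOddOnes i (n + 1) + pfOnes (i + 1) n := by
  have h := pfOnes_even_even i (n + 1)
  rw [show 2 * (n + 1) = 2 * n + 1 + 1 by ring, pfOnes_succ_left, pfOnes_succ_left i,
    pf_two_mul] at h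
  omega

theorem pfOnes_odd_even (i n : ℕ) :
    pfOnes (2 * i + 1) (2 * n) = pfOddOnes i n + pfOnes (i + 1) n := by
  have h := pfOnes_even_odd i n
  rw [pfOnes_succ_left, pfOnes_succ_left i, pf_two_mul] at h
  omega

theorem pfOnesSet_four_mul (k : ℕ) : pfOnesSet (4 * k) = (k + ·) '' pfOnesSet (2 * k) := by
  ext c
  constructor
  · rintro ⟨i, hi, rfl⟩
    rw [show 4 * k = 2 * (2 * k) by ring]
    obtain ⟨j, rfl | rfl⟩ := Nat.even_or_odd' i
    · exact ⟨_, ⟨j, by omega, rfl⟩, by rw [pfOnes_even_even, pfOddOnes_two_mul]⟩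
    · exact ⟨_, ⟨j + 1, by omega, rfl⟩, by rw [pfOnes_odd_even, pfOddOnes_two_mul]⟩
  · rintro ⟨_, ⟨j, hj, rfl⟩, rfl⟩
    exact ⟨2 * j, by omega, by
      rw [show 4 * k = 2 * (2 * k) by ring, pfOnes_even_even, pfOddOnes_two_mul]⟩

theorem exists_mem_pfOnesSet_succ {n c : ℕ} (hc : c ∈ pfOnesSet n) :
    ∃ d ∈ pfOnesSet (n + 1), d = c ∨ d = c + 1 := by
  obtain ⟨i, hi, rfl⟩ := hc
  refine ⟨_, ⟨i, hi, rfl⟩, ?_⟩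
  rw [pfOnes_succ]
  rcases pf_eq_zero_or_one (i + n) with h | h <;> simp [h]

/-- Every number of ones in a factor of length `8 * n + 7` comes, up to a constant, from a
factor of length `4 * n + 4`. -/
theorem mem_pfOnesSet_eight_mul_add_seven {n c : ℕ} (hc : c ∈ pfOnesSet (8 * n + 7)) :
    ∃ d ∈ pfOnesSet (4 * n + 4), c = 2 * n + 1 + d ∨ c = 2 * n + 2 + d := by
  obtain ⟨i, hi, rfl⟩ := hc
  rw [show 8 * n + 7 = 2 * (4 * n + 3) + 1 by ring]
  obtain ⟨j, rfl | rfl⟩ := Nat.even_or_odd' i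
  · refine ⟨_, ⟨j, by omega, rfl⟩, ?_⟩
    rw [pfOnes_even_odd, show 4 * n + 3 = 2 * (2 * n + 1) + 1 by ring,
      pfOddOnes_two_mul_add_one, show 2 * (2 * n + 1) + 1 + 1 = 4 * n + 4 by ring]
    omega
  · obtain ⟨d, hd, h⟩ := exists_mem_pfOnesSet_succ
      (⟨j + 1, by omega, rfl⟩ : pfOnes (j + 1) (4 * n + 3) ∈ pfOnesSet (4 * n + 3))
    refine ⟨d, hd, ?_⟩
    rw [pfOnes_odd_odd, show 4 * n + 3 + 1 = 2 * (2 * n + 2) by ring, pfOddOnes_two_mul]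
    omega

theorem pfOnesSet_sixteen_mul_add_fifteen (n : ℕ) :
    pfOnesSet (16 * n + 15) =
      (7 * n + 6 + ·) '' (pfOnesSet (2 * n + 2) ∪ (· + 1) '' pfOnesSet (2 * n + 2)) := by
  have h4 : pfOnesSet (4 * n + 4) = (n + 1 + ·) '' pfOnesSet (2 * n + 2) :=
    pfOnesSet_four_mul (n + 1)
  have h8 : pfOnesSet (8 * n + 8) = (2 * n + 2 + ·) '' pfOnesSet (4 * n + 4) := by
    have h := pfOnesSet_four_mul (2 * n + 2)
    rwa [show 4 * (2 * n + 2) = 8 * n + 8 by ring,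
      show 2 * (2 * n + 2) = 4 * n + 4 by ring] at h
  have key : ∀ j, pfOnes (2 * j) (16 * n + 15) = 4 * n + 3 + j % 2 + pfOnes j (8 * n + 8) := by
    intro j
    rw [show 16 * n + 15 = 2 * (2 * (4 * n + 3) + 1) + 1 by ring, pfOnes_even_odd,
      pfOddOnes_two_mul_add_one, show 2 * (4 * n + 3) + 1 + 1 = 8 * n + 8 by ring]
  ext c
  constructor
  · intro hc
    suffices h : ∃ d ∈ pfOnesSet (2 * n + 2), c = 7 * n + 6 + d ∨ c = 7 * n + 6 + (d + 1) by
      obtain ⟨d, hd, rfl | rfl⟩ := h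
      · exact ⟨d, Or.inl hd, rfl⟩
      · exact ⟨d + 1, Or.inr ⟨d, hd, rfl⟩, rfl⟩
    obtain ⟨i, hi, rfl⟩ := hc
    obtain ⟨j, rfl | rfl⟩ := Nat.even_or_odd' i
    · have hm : pfOnes j (8 * n + 8) ∈ pfOnesSet (8 * n + 8) := ⟨j, by omega, rfl⟩
      rw [h8, h4] at hm
      obtain ⟨_, ⟨d, hd, rfl⟩, h⟩ := hm
      refine ⟨d, hd, ?_⟩
      rw [key, ← h]
      dsimp only
      omega
    · obtain ⟨e, he, h⟩ := mem_pfOnesSet_eight_mul_add_seven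
        (⟨j + 1, by omega, rfl⟩ : pfOnes (j + 1) (8 * n + 7) ∈ pfOnesSet (8 * n + 7))
      rw [h4] at he
      obtain ⟨d, hd, rfl⟩ := he
      refine ⟨d, hd, ?_⟩
      rw [show 16 * n + 15 = 2 * (8 * n + 7) + 1 by ring, pfOnes_odd_odd,
        show 8 * n + 7 + 1 = 2 * (4 * n + 4) by ring, pfOddOnes_two_mul]
      dsimp only at h
      omega
  · have lift : ∀ d ∈ pfOnesSet (2 * n + 2), ∀ ε < 2,
        7 * n + 6 + (d + ε) ∈ pfOnesSet (16 * n + 15) := by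
      rintro _ ⟨i, hi, rfl⟩ ε hε
      have h : pfOnes (2 * i) (4 * n + 4) = n + 1 + pfOnes i (2 * n + 2) := by
        rw [show 4 * n + 4 = 2 * (2 * (n + 1)) by ring, pfOnes_even_even, pfOddOnes_two_mul,
          mul_add_one]
      have hodd : pfOddOnes (2 * i - ε) (4 * n + 4) = 2 * n + 2 := by
        rw [show 4 * n + 4 = 2 * (2 * n + 2) by ring, pfOddOnes_two_mul]
      -- The start `4 * i - ε` halves to `2 * i`, and `ε` selects the sign at the odd positions.
      have h' : pfOnes (4 * i - ε) (8 * n + 8) = 2 * n + 2 + pfOnes (2 * i) (4 * n + 4) := by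
        rw [show 8 * n + 8 = 2 * (4 * n + 4) by ring]
        obtain rfl | rfl : ε = 0 ∨ ε = 1 := by omega
        · rw [Nat.sub_zero, show 4 * i = 2 * (2 * i) by ring, pfOnes_even_even]
          exact congrArg (· + _) hodd
        · rw [show 4 * i - 1 = 2 * (2 * i - 1) + 1 by omega, pfOnes_odd_even, hodd,
            show 2 * i - 1 + 1 = 2 * i by omega]
      refine ⟨2 * (4 * i - ε), by omega, ?_⟩
      rw [key, h', h]
      omega
    rintro ⟨_, hd | ⟨d, hd, rfl⟩, rfl⟩
    · exact lift _ hd 0 (by norm_num)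
    · exact lift _ hd 1 (by norm_num)

theorem exists_eq_of_step_le_one {f : ℕ → ℕ}
    (hf : ∀ i, f (i + 1) ≤ f i + 1 ∧ f i ≤ f (i + 1) + 1) {i j v : ℕ} (hij : i ≤ j)
    (hv : f i ≤ v ∧ v ≤ f j ∨ f j ≤ v ∧ v ≤ f i) : ∃ k, i ≤ k ∧ f k = v := by
  induction j, hij using Nat.le_induction with
  | base => exact ⟨i, le_rfl, by omega⟩
  | succ j hij ih =>
    by_cases h : v = f (j + 1)
    · exact ⟨j + 1, by omega, h.symm⟩
    · have := hf j
      exact ih (by omega)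

theorem pfOnes_step (i n : ℕ) :
    pfOnes (i + 1) n ≤ pfOnes i n + 1 ∧ pfOnes i n ≤ pfOnes (i + 1) n + 1 := by
  have h := (pfOnes_succ_left i n).symm.trans (pfOnes_succ i n)
  have h1 := pf_eq_zero_or_one i
  have h2 := pf_eq_zero_or_one (i + n)
  omega

theorem pfOnesSet_ordConnected (n : ℕ) : (pfOnesSet n).OrdConnected := by
  refine ⟨?_⟩
  rintro _ ⟨i, hi, rfl⟩ _ ⟨j, hj, rfl⟩ v ⟨h1, h2⟩
  have hf := fun i => pfOnes_step i n
  rcases le_total i j with hij | hij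
  · obtain ⟨k, hk, h⟩ := exists_eq_of_step_le_one (f := (pfOnes · n)) hf hij (Or.inl ⟨h1, h2⟩)
    exact ⟨k, by omega, h.symm⟩
  · obtain ⟨k, hk, h⟩ := exists_eq_of_step_le_one (f := (pfOnes · n)) hf hij (Or.inr ⟨h1, h2⟩)
    exact ⟨k, by omega, h.symm⟩

theorem pfOnes_le (i n : ℕ) : pfOnes i n ≤ n := by
  induction n with
  | zero => rfl
  | succ n ih =>
    rw [pfOnes_succ]
    have := pf_eq_zero_or_one (i + n)
    omega

theorem pfOnesSet_finite (n : ℕ) : (pfOnesSet n).Finite :=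
  (Set.finite_Iic n).subset (by rintro _ ⟨i, -, rfl⟩; exact pfOnes_le i n)

theorem pfOnesSet_nonempty (n : ℕ) : (pfOnesSet n).Nonempty := ⟨_, 1, le_rfl, rfl⟩

theorem Set.OrdConnected.ncard_union_image_succ {s : Set ℕ} (hs : s.OrdConnected)
    (hfin : s.Finite) (hne : s.Nonempty) : (s ∪ (· + 1) '' s).ncard = s.ncard + 1 := by
  have hmin : sInf s ∈ s := Nat.sInf_mem hne
  have heq : s ∪ (· + 1) '' s = insert (sInf s) ((· + 1) '' s) := by
    ext x
    constructor
    · rintro (hx | hx)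
      · rcases (Nat.sInf_le hx).eq_or_lt with h | h
        · exact Or.inl h.symm
        · exact Or.inr ⟨x - 1, hs.out hmin hx ⟨by omega, by omega⟩, by dsimp only; omega⟩
      · exact Or.inr hx
    · rintro (rfl | hx)
      · exact Or.inl hmin
      · exact Or.inr hx
  have hnot : sInf s ∉ (· + 1) '' s := by
    rintro ⟨y, hy, h⟩
    have := Nat.sInf_le hy
    dsimp only at h
    omega
  rw [heq, Set.ncard_insert_of_notMem hnot (hfin.image _),
    Set.ncard_image_of_injective _ (add_left_injective 1)]

theorem pfFactor_succ (i n : ℕ) : pfFactor i (n + 1) = pfFactor i n ++ [pf (i + n)] := by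
  simp [pfFactor, List.range_succ]

theorem count_one_pfFactor (i n : ℕ) : (pfFactor i n).count 1 = pfOnes i n := by
  induction n with
  | zero => rfl
  | succ n ih =>
    rw [pfFactor_succ, List.count_append, ih, pfOnes_succ]
    rcases pf_eq_zero_or_one (i + n) with h | h <;> simp [h]

theorem count_zero_pfFactor (i n : ℕ) : (pfFactor i n).count 0 = n - pfOnes i n := by
  induction n with
  | zero => rfl
  | succ n ih =>
    have := pfOnes_le i n
    rw [pfFactor_succ, List.count_append, ih, pfOnes_succ]
    rcases pf_eq_zero_or_one (i + n) with h | h <;> simp [h]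
    omega

theorem ρ_eq_ncard_pfOnesSet (n : ℕ) : ρ n = (pfOnesSet n).ncard := by
  have hinj : Function.Injective (fun c : ℕ => (n - c, c)) := fun a b h => (Prod.ext_iff.1 h).2
  rw [← Set.ncard_image_of_injective _ hinj]
  unfold ρ
  congr 1
  ext p
  simp only [count_one_pfFactor, count_zero_pfFactor]
  constructor
  · rintro ⟨i, hi, rfl⟩
    exact ⟨_, ⟨i, hi, rfl⟩, rfl⟩
  · rintro ⟨_, ⟨i, hi, rfl⟩, rfl⟩
    exact ⟨i, hi, rfl⟩

theorem pf_rho_sixteen_mul_add_fifteen : ∀ n : ℕ, ρ (16 * n + 15) = ρ (2 * n + 2) + 1 := by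
  intro n
  rw [ρ_eq_ncard_pfOnesSet, ρ_eq_ncard_pfOnesSet, pfOnesSet_sixteen_mul_add_fifteen,
    Set.ncard_image_of_injective _ (add_right_injective _),
    (pfOnesSet_ordConnected _).ncard_union_image_succ (pfOnesSet_finite _) (pfOnesSet_nonempty _)]
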